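/- Let n ≥ 2 and 1 ≤ p ≤ n−1. The set of x ∈ ℝ^{(n,p)} which are projectively very well approximable has Lebesgue measure 0 in ℝ^{(n,p)}. -/

import Mathlib

open Matrix MeasureTheory

attribute [local instance] Matrix.normedAddCommGroup

noncomputable instance matrixMeasureSpace {n p : ℕ} :
    MeasureSpace (Matrix (Fin n) (Fin p) ℝ) :=
  inferInstanceAs (MeasureSpace (Fin n → Fin p → ℝ))

/-- The homogeneous exponent `h(x)` of `x ∈ ℝ^{(n,p)}`: the infimum of `u ∈ ℝ` for which
there exists `c > 0` such that `‖ωx‖ > c‖ω‖^{−u}` for all nonzero `ω ∈ M(n,ℤ)`. -/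
noncomputable def homExp {n p : ℕ} (x : Matrix (Fin n) (Fin p) ℝ) : ℝ :=
  sInf {u : ℝ | ∃ c > (0 : ℝ), ∀ ω : Matrix (Fin n) (Fin n) ℤ, ω ≠ 0 →
    c * ‖ω.map (Int.cast : ℤ → ℝ)‖ ^ (-u) < ‖(ω.map (Int.cast : ℤ → ℝ)) * x‖}

section PV

theorem pv_exists_norm {n : ℕ} {E : Type*} [SeminormedAddCommGroup E] (hn : 0 < n)
    (f : Fin n → E) : ∃ i, ‖f i‖ = ‖f‖ := by
  have : Nonempty (Fin n) := ⟨⟨0, hn⟩⟩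
  obtain ⟨i, hi⟩ := Finite.exists_max (fun i => ‖f i‖)
  exact ⟨i, le_antisymm (norm_le_pi_norm f i) ((pi_norm_le_iff_of_nonempty f).2 hi)⟩

theorem pv_t1 (n : ℕ) : Module.finrank ℤ (Submodule.span ℤ (Set.range (Pi.basisFun ℝ (Fin n)))) = n := by
    rw [ZLattice.rank ℝ]; simp
theorem pv_t2 (n : ℕ) (q : Fin n → ℤ) : (fun i => (q i : ℝ)) ∈ (Submodule.span ℤ (Set.range (Pi.basisFun ℝ (Fin n)))) := by
    rw [Module.Basis.mem_span_iff_repr_mem]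
    intro i
    exact ⟨q i, by simp⟩
theorem pv_t3 (n : ℕ) (L : Submodule ℤ (Fin n → ℝ)) (hm : ∀ q : Fin n → ℤ, (fun i => (q i : ℝ)) ∈ L) : Function.Injective (fun q : Fin n → ℤ => (⟨_, hm q⟩ : L)) := by
    intro a b hab
    have := congrArg Subtype.val hab
    funext i
    have := congrFun this i
    simpa using this
theorem pv_t4 (n : ℕ) (s : ℝ) (L : Submodule ℤ (Fin n → ℝ)) (hm : ∀ q : Fin n → ℤ, (fun i => (q i : ℝ)) ∈ L) (h : Summable fun z : L ↦ ‖z‖ ^ s): 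
    Summable fun q : Fin n → ℤ => ‖(fun i => (q i : ℝ))‖ ^ s := by
  have h2 := Summable.comp_injective (f := fun z : L => ‖z‖ ^ s) (i := fun q : Fin n → ℤ => (⟨fun i => (q i : ℝ), hm q⟩ : L)) h (pv_t3 n L hm)
  refine h2.congr fun q => ?_
  simp only [Function.comp_apply]
  rfl
theorem pv_t5 (n : ℕ) (s : ℝ) (hs : s < -(n : ℝ)) : 
    Summable fun z : (Submodule.span ℤ (Set.range (Pi.basisFun ℝ (Fin n)))) ↦ ‖z‖ ^ s := by
  exact ZLattice.summable_norm_rpow _ s (by rw [pv_t1]; exact hs)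

theorem pv_summable (n : ℕ) (s : ℝ) (hs : s < -(n : ℝ)) :
    Summable fun q : Fin n → ℤ => ‖(fun i => (q i : ℝ))‖ ^ s :=
  pv_t4 n s _ (pv_t2 n) (pv_t5 n s hs)

theorem pv_slab (m p : ℕ) (R : ℝ) (q : Fin (m + 1) → ℝ) (hq : q ≠ 0) (ε : ℝ) (hε : 0 ≤ ε) :
    volume {x : Fin (m + 1) → Fin p → ℝ | (∀ i, ‖x i‖ ≤ R) ∧ ‖∑ i, q i • x i‖ ≤ ε} ≤
      volume {z : Fin m → Fin p → ℝ | ∀ i, ‖z i‖ ≤ R} *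
        ENNReal.ofReal ((2 * (ε / ‖q‖)) ^ p) := by
  obtain ⟨i, hi⟩ := pv_exists_norm (Nat.succ_pos m) q
  have hN : 0 < ‖q‖ := norm_pos_iff.2 hq
  have hqi : q i ≠ 0 := by
    intro h; rw [h, norm_zero] at hi; exact hN.ne hi
  have hmp := volume_preserving_piFinSuccAbove (fun _ : Fin (m + 1) => Fin p → ℝ) i
  set T : Set ((Fin p → ℝ) × (Fin m → Fin p → ℝ)) :=
    {w | (∀ k, ‖w.2 k‖ ≤ R) ∧ ‖q i • w.1 + ∑ k, q (i.succAbove k) • w.2 k‖ ≤ ε} with hT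
  have hTm : MeasurableSet T := by
    apply IsClosed.measurableSet
    rw [hT, Set.ofPred_and, Set.ofPred_forall]
    refine IsClosed.inter (isClosed_iInter fun k => ?_) ?_
    · exact isClosed_le (by fun_prop) (by fun_prop)
    · exact isClosed_le (by fun_prop) (by fun_prop)
  have hsub : {x : Fin (m + 1) → Fin p → ℝ | (∀ i, ‖x i‖ ≤ R) ∧ ‖∑ i, q i • x i‖ ≤ ε} ⊆
      (MeasurableEquiv.piFinSuccAbove (fun _ : Fin (m + 1) => Fin p → ℝ) i) ⁻¹' T := by
    rintro x ⟨h1, h2⟩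
    refine ⟨fun k => h1 _, ?_⟩
    rw [Fin.sum_univ_succAbove _ i] at h2
    exact h2
  refine (measure_mono hsub).trans ?_
  rw [hmp.measure_preimage hTm.nullMeasurableSet]
  rw [Measure.volume_eq_prod, Measure.prod_apply_symm hTm]
  have hZ : MeasurableSet {z : Fin m → Fin p → ℝ | ∀ i, ‖z i‖ ≤ R} := by
    apply IsClosed.measurableSet
    rw [Set.ofPred_forall]
    exact isClosed_iInter fun k => isClosed_le (by fun_prop) (by fun_prop)
  calc _ ≤ ∫⁻ z : Fin m → Fin p → ℝ, Set.indicator {z | ∀ i, ‖z i‖ ≤ R}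
        (fun _ => ENNReal.ofReal ((2 * (ε / ‖q‖)) ^ p)) z := by
        refine lintegral_mono fun z => ?_
        by_cases hz : ∀ i, ‖z i‖ ≤ R
        · rw [Set.indicator_of_mem (by exact hz)]
          have := Real.volume_pi_closedBall (-((q i)⁻¹ • ∑ k, q (i.succAbove k) • z k))
            (r := ε / ‖q‖) (by positivity)
          rw [Fintype.card_fin] at this
          rw [← this]
          refine measure_mono ?_
          rintro y ⟨-, hy⟩
          simp only at hy
          rw [Metric.mem_closedBall, dist_eq_norm, sub_neg_eq_add, le_div_iff₀ hN, ← hi, mul_comm,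
            ← norm_smul, smul_add, smul_inv_smul₀ hqi]
          exact hy
        · rw [Set.indicator_of_notMem (by exact hz)]
          refine le_of_eq ?_
          convert measure_empty (μ := volume)
          ext y
          simp only [Set.mem_preimage, hT, Set.mem_ofPred_eq, Set.mem_empty_iff_false, iff_false]
          exact fun h => hz h.1
    _ = _ := by
        rw [lintegral_indicator_const hZ, mul_comm]

theorem pv_null_box (m p : ℕ) (hp : 1 ≤ p) (R : ℝ) (u : ℝ)
    (hu : ((m + 1 : ℕ) : ℝ) < (u + 1) * p) :
    volume {x : Fin (m + 1) → Fin p → ℝ | (∀ i, ‖x i‖ ≤ R) ∧ ∀ c > (0 : ℝ),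
      ∃ q : Fin (m + 1) → ℤ, (fun i => (q i : ℝ)) ≠ 0 ∧
        ‖∑ i, (q i : ℝ) • x i‖ ≤ c * ‖(fun i => (q i : ℝ))‖ ^ (-u)} = 0 := by
  set A := {x : Fin (m + 1) → Fin p → ℝ | (∀ i, ‖x i‖ ≤ R) ∧ ∀ c > (0 : ℝ),
      ∃ q : Fin (m + 1) → ℤ, (fun i => (q i : ℝ)) ≠ 0 ∧
        ‖∑ i, (q i : ℝ) • x i‖ ≤ c * ‖(fun i => (q i : ℝ))‖ ^ (-u)} with hA
  set V := volume {z : Fin m → Fin p → ℝ | ∀ i, ‖z i‖ ≤ R} with hV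
  have hVfin : V ≠ ⊤ := by
    refine ((measure_mono (?_ : _ ⊆ Metric.closedBall (0 : Fin m → Fin p → ℝ) |R|)).trans_lt
      measure_closedBall_lt_top).ne
    intro z hz
    rw [mem_closedBall_zero_iff, pi_norm_le_iff_of_nonneg (abs_nonneg R)]
    exact fun i => (hz i).trans (le_abs_self R)
  have hsum := pv_summable (m + 1) (-((u + 1) * p)) (by linarith)
  set K := ∑' q : Fin (m + 1) → ℤ, ENNReal.ofReal (‖(fun i => (q i : ℝ))‖ ^ (-((u + 1) * p)))
    with hK
  have hKfin : K ≠ ⊤ := hsum.tsum_ofReal_ne_top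
  have key : ∀ c > (0 : ℝ), volume A ≤ ENNReal.ofReal ((2 * c) ^ p) * (V * K) := by
    intro c hc
    have hsub : A ⊆ ⋃ q : Fin (m + 1) → ℤ, {x | (fun i => (q i : ℝ)) ≠ 0 ∧ (∀ i, ‖x i‖ ≤ R) ∧
        ‖∑ i, (q i : ℝ) • x i‖ ≤ c * ‖(fun i => (q i : ℝ))‖ ^ (-u)} := by
      rintro x ⟨h1, h2⟩
      obtain ⟨q, h3, h4⟩ := h2 c hc
      exact Set.mem_iUnion.2 ⟨q, h3, h1, h4⟩
    refine (measure_mono hsub).trans ((measure_iUnion_le _).trans ?_)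
    rw [hK, ← ENNReal.tsum_mul_left, ← ENNReal.tsum_mul_left]
    refine ENNReal.tsum_le_tsum fun q => ?_
    by_cases hq : (fun i => (q i : ℝ)) = 0
    · simp [hq]
    · have hN : 0 < ‖(fun i => (q i : ℝ))‖ := norm_pos_iff.2 hq
      simp only [ne_eq, hq, not_false_eq_true, true_and]
      refine (pv_slab m p R _ hq _ (by positivity)).trans (le_of_eq ?_)
      rw [← hV, mul_left_comm, ← ENNReal.ofReal_mul (by positivity)]
      congr 2
      generalize ‖(fun i => (q i : ℝ))‖ = N at hN
      rw [← neg_mul, Real.rpow_mul hN.le, Real.rpow_natCast, ← mul_pow]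
      congr 1
      rw [neg_add, Real.rpow_add hN, Real.rpow_neg_one]
      ring
  have hlim : Filter.Tendsto (fun k : ℕ => ENNReal.ofReal ((2 * (1 / ((k : ℝ) + 1))) ^ p) * (V * K))
      Filter.atTop (nhds 0) := by
    have h0 : Filter.Tendsto (fun k : ℕ => (2 * (1 / ((k : ℝ) + 1))) ^ p)
        Filter.atTop (nhds 0) := by
      have := (tendsto_one_div_add_atTop_nhds_zero_nat (𝕜 := ℝ)).const_mul 2 |>.pow p
      simpa [zero_pow (by omega : p ≠ 0)] using this
    have h1 := ENNReal.tendsto_ofReal h0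
    have := ENNReal.Tendsto.mul_const (b := V * K) h1 (Or.inr (ENNReal.mul_ne_top hVfin hKfin))
    simpa using this
  exact le_antisymm (ge_of_tendsto' hlim fun k => key _ (by positivity)) bot_le

theorem pv_null (m p : ℕ) (hp : 1 ≤ p) (u : ℝ) (hu : ((m + 1 : ℕ) : ℝ) < (u + 1) * p) :
    volume {x : Fin (m + 1) → Fin p → ℝ | ∀ c > (0 : ℝ),
      ∃ q : Fin (m + 1) → ℤ, (fun i => (q i : ℝ)) ≠ 0 ∧
        ‖∑ i, (q i : ℝ) • x i‖ ≤ c * ‖(fun i => (q i : ℝ))‖ ^ (-u)} = 0 := by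
  refine measure_mono_null ?_ (measure_iUnion_null fun k : ℕ => pv_null_box m p hp (k : ℝ) u hu)
  intro x hx
  obtain ⟨k, hk⟩ := exists_nat_ge ‖x‖
  exact Set.mem_iUnion.2 ⟨k, fun i => (norm_le_pi_norm x i).trans hk, hx⟩

end PV


/-- **Proposition 4.3.** The set of `x ∈ ℝ^{(n,p)}` which are projectively very well
approximable (i.e. `h(x) > (n−p)/p`) has Lebesgue measure `0`. -/
theorem pvwa_measure_zero (n p : ℕ) (hn : 2 ≤ n) (hp : 1 ≤ p) (hpn : p ≤ n - 1) :
    volume {x : Matrix (Fin n) (Fin p) ℝ | ((n : ℝ) - p) / p < homExp x} = 0 := by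
  obtain ⟨m, rfl⟩ : ∃ m, n = m + 1 := ⟨n - 1, by omega⟩
  have hp0 : (0 : ℝ) < p := by exact_mod_cast hp
  set v : ℝ := (((m + 1 : ℕ) : ℝ) - p) / p with hv
  have hv0 : 0 ≤ v := by
    have : (p : ℝ) ≤ ((m + 1 : ℕ) : ℝ) := by exact_mod_cast (by omega : p ≤ m + 1)
    exact div_nonneg (by linarith) hp0.le
  have hnull : ∀ k : ℕ, volume {x : Fin (m + 1) → Fin p → ℝ | ∀ c > (0 : ℝ),
      ∃ q : Fin (m + 1) → ℤ, (fun i => (q i : ℝ)) ≠ 0 ∧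
        ‖∑ i, (q i : ℝ) • x i‖ ≤ c * ‖(fun i => (q i : ℝ))‖ ^ (-(v + 1 / ((k : ℝ) + 1)))} = 0 := by
    intro k
    apply pv_null m p hp
    have h1 : (v + 1) * p = ((m + 1 : ℕ) : ℝ) := by rw [hv]; field_simp; ring
    have h2 : 0 < 1 / ((k : ℝ) + 1) := by positivity
    nlinarith
  refine measure_mono_null (μ := (volume : Measure (Fin (m + 1) → Fin p → ℝ))) ?_
    (measure_iUnion_null hnull)
  intro (x : Matrix (Fin (m + 1)) (Fin p) ℝ) hx
  have hx : v < homExp x := hx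
  obtain ⟨k, hk⟩ := exists_nat_one_div_lt (sub_pos.2 hx)
  refine Set.mem_iUnion.2 ⟨k, ?_⟩
  intro c hc
  by_contra hcon
  push Not at hcon
  set u : ℝ := v + 1 / ((k : ℝ) + 1) with hu
  have hlt : u < homExp x := by linarith
  refine absurd hlt (not_lt.2 ?_)
  unfold homExp
  set S := {u : ℝ | ∃ c > (0 : ℝ), ∀ ω : Matrix (Fin (m + 1)) (Fin (m + 1)) ℤ, ω ≠ 0 →
    c * ‖ω.map (Int.cast : ℤ → ℝ)‖ ^ (-u) < ‖(ω.map (Int.cast : ℤ → ℝ)) * x‖} with hS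
  by_cases hb : BddBelow S
  · refine csInf_le hb ⟨c, hc, ?_⟩
    intro ω hω
    obtain ⟨i, hi⟩ := pv_exists_norm (E := Fin (m + 1) → ℝ) (Nat.succ_pos m)
      (ω.map (Int.cast : ℤ → ℝ))
    have hi' : ‖(fun j => (ω i j : ℝ))‖ = ‖ω.map (Int.cast : ℤ → ℝ)‖ := hi
    have hne : ω.map (Int.cast : ℤ → ℝ) ≠ 0 := by
      intro h
      apply hω
      ext a b
      have := congrFun (congrFun h a) b
      simpa using this
    have hne' : (fun j => (ω i j : ℝ)) ≠ 0 := by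
      rw [← norm_ne_zero_iff, hi', norm_ne_zero_iff]; exact hne
    have h := hcon (ω i) hne'
    rw [hi'] at h
    refine h.trans_le ?_
    refine le_trans (le_of_eq ?_)
      (norm_le_pi_norm (G := fun _ => Fin p → ℝ) ((ω.map (Int.cast : ℤ → ℝ)) * x) i)
    congr 1
    funext j
    rw [Finset.sum_apply]
    rfl
  · rw [Real.sInf_of_not_bddBelow hb]
    positivity
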